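/- An n-atomic domain D is an n-UFD if and only if every normal irreducible element of D is prime. -/

import Mathlib

/-- `a` is a nonzero nonunit (membership in `D^#`). -/
def NNU {D : Type*} [Ring D] (a : D) : Prop := a ≠ 0 ∧ ¬ IsUnit a

/-- `a ∣ b` in the sense of the paper: `b = c * a * d` for some `c, d`. -/
def PDvd {D : Type*} [Ring D] (a b : D) : Prop := ∃ c d : D, b = c * a * d

/-- `a ~ b`: `a = u * b * v` for units `u, v`. -/
def PAssoc {D : Type*} [Ring D] (a b : D) : Prop :=
  ∃ u v : Dˣ, a = (u : D) * b * (v : D)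

/-- `a` is irreducible: a nonzero nonunit that is not a product of two nonunits. -/
def PIrred {D : Type*} [Ring D] (a : D) : Prop :=
  NNU a ∧ ∀ y z : D, a = y * z → IsUnit y ∨ IsUnit z

/-- `a` is normal: `aD = Da`. -/
def PNormal {D : Type*} [Ring D] (a : D) : Prop :=
  {x : D | ∃ d : D, x = a * d} = {x : D | ∃ d : D, x = d * a}
/-- `D` is n-atomic: every nonzero nonunit is a product of normal irreducible elements. -/
def NAtomic (D : Type*) [Ring D] : Prop :=
  ∀ a : D, NNU a → ∃ l : List D, l ≠ [] ∧ (∀ p ∈ l, PNormal p ∧ PIrred p) ∧ a = l.prod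

/-- A factorization of `r` into normal irreducible elements. -/
def NFactorization {D : Type*} [Ring D] (r : D) (l : List D) : Prop :=
  (∀ p ∈ l, PNormal p ∧ PIrred p) ∧ r = l.prod

/-- `D` is an n-UFD: n-atomic, and factorizations into normal irreducibles are
unique up to order and associates. -/
def NUFD (D : Type*) [Ring D] : Prop :=
  NAtomic D ∧ ∀ r : D, NNU r → ∀ l t : List D, NFactorization r l → NFactorization r t →
    ∃ σ : Fin l.length ≃ Fin t.length, ∀ i, PAssoc (l.get i) (t.get (σ i))

theorem PNormal.exists_mul_eq {D : Type*} [Ring D] {a : D} (ha : PNormal a) (x : D) :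
    ∃ y, x * a = a * y := by
  have h : x * a ∈ {x : D | ∃ d : D, x = d * a} := ⟨x, rfl⟩
  rwa [← ha] at h

theorem PNormal.exists_eq_mul {D : Type*} [Ring D] {a : D} (ha : PNormal a) (x : D) :
    ∃ y, a * x = y * a := by
  have h : a * x ∈ {x : D | ∃ d : D, x = a * d} := ⟨x, rfl⟩
  rwa [ha] at h

theorem PNormal.of_exists {D : Type*} [Ring D] {a : D} (h₁ : ∀ x, ∃ y, a * x = y * a)
    (h₂ : ∀ x, ∃ y, x * a = a * y) : PNormal a := by
  ext x
  constructor
  · rintro ⟨d, rfl⟩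
    exact h₁ d
  · rintro ⟨d, rfl⟩
    exact h₂ d

theorem PNormal.zero {D : Type*} [Ring D] : PNormal (0 : D) :=
  .of_exists (fun _ => ⟨0, by simp⟩) (fun _ => ⟨0, by simp⟩)

theorem IsUnit.pNormal {D : Type*} [Ring D] {a : D} (ha : IsUnit a) : PNormal a := by
  obtain ⟨u, rfl⟩ := ha
  exact .of_exists (fun x => ⟨u * x * (u⁻¹ : Dˣ), by simp⟩)
    (fun x => ⟨(u⁻¹ : Dˣ) * x * u, by simp [mul_assoc]⟩)

theorem PNormal.mul {D : Type*} [Ring D] {a b : D} (ha : PNormal a) (hb : PNormal b) :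
    PNormal (a * b) := by
  refine .of_exists (fun x => ?_) (fun x => ?_)
  · obtain ⟨y, hy⟩ := hb.exists_eq_mul x
    obtain ⟨z, hz⟩ := ha.exists_eq_mul y
    exact ⟨z, by rw [mul_assoc, hy, ← mul_assoc, hz, mul_assoc]⟩
  · obtain ⟨y, hy⟩ := ha.exists_mul_eq x
    obtain ⟨z, hz⟩ := hb.exists_mul_eq y
    exact ⟨z, by rw [← mul_assoc, hy, mul_assoc, hz, mul_assoc]⟩

theorem PNormal.list_prod {D : Type*} [Ring D] {l : List D} (h : ∀ p ∈ l, PNormal p) :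
    PNormal l.prod := by
  induction l with
  | nil => simpa using (isUnit_one (M := D)).pNormal
  | cons p l ih =>
    rw [List.prod_cons]
    exact (h p (by simp)).mul (ih fun q hq => h q (by simp [hq]))

theorem NAtomic.pNormal {D : Type*} [Ring D] (hat : NAtomic D) (a : D) : PNormal a := by
  by_cases h0 : a = 0
  · exact h0 ▸ PNormal.zero
  by_cases hu : IsUnit a
  · exact hu.pNormal
  obtain ⟨l, -, hl, rfl⟩ := hat a ⟨h0, hu⟩
  exact PNormal.list_prod fun p hp => (hl p hp).1

theorem PNormal.pDvd_iff_dvd {D : Type*} [Ring D] {p : D} (hp : PNormal p) (a : D) :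
    PDvd p a ↔ p ∣ a := by
  constructor
  · rintro ⟨c, d, rfl⟩
    obtain ⟨y, hy⟩ := hp.exists_mul_eq c
    exact ⟨y * d, by rw [hy, mul_assoc]⟩
  · rintro ⟨d, rfl⟩
    exact ⟨1, d, by simp⟩

theorem dvd_list_prod_of_dvd_mem {D : Type*} [Ring D] (hN : ∀ a : D, PNormal a) {p q : D}
    {l : List D} (hq : q ∈ l) (h : p ∣ q) : p ∣ l.prod := by
  obtain ⟨l₁, l₂, rfl⟩ := List.append_of_mem hq
  obtain ⟨c, rfl⟩ := h
  exact ((hN p).pDvd_iff_dvd _).1 ⟨l₁.prod, c * l₂.prod, by simp [mul_assoc]⟩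

theorem PIrred.associated_of_dvd {D : Type*} [Ring D] {p q : D} (hp : PIrred p) (hq : PIrred q) (h : p ∣ q) :
    Associated p q := by
  obtain ⟨c, rfl⟩ := h
  obtain h | ⟨u, rfl⟩ := hq.2 p c rfl
  · exact absurd h hp.1.2
  · exact ⟨u, rfl⟩

section Domain

variable {D : Type*} [Ring D] [IsDomain D]

/-- Moving a unit past a normal element gives a unit. -/
theorem PNormal.exists_unit_mul_eq {a : D} (ha : PNormal a) (u : Dˣ) :
    ∃ v : Dˣ, (u : D) * a = a * v := by
  by_cases h0 : a = 0
  · exact ⟨1, by simp [h0]⟩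
  obtain ⟨y, hy⟩ := ha.exists_mul_eq (u : D)
  obtain ⟨z, hz⟩ := ha.exists_mul_eq ((u⁻¹ : Dˣ) : D)
  have h : y * z = 1 := by
    apply mul_left_cancel₀ h0
    rw [← mul_assoc, ← hy, mul_assoc, ← hz, ← mul_assoc]
    simp
  obtain ⟨v, rfl⟩ := IsUnit.of_mul_eq_one z h
  exact ⟨v, hy⟩

/-- If `a` is normal and `a * x = y * a` with `y` a unit, then `x` is a unit. -/
theorem PNormal.isUnit_of_mul_eq {a x y : D} (ha : PNormal a) (h0 : a ≠ 0)
    (h : a * x = y * a) (hy : IsUnit y) : IsUnit x := by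
  obtain ⟨u, rfl⟩ := hy
  obtain ⟨v, hv⟩ := ha.exists_unit_mul_eq u
  rw [hv] at h
  exact mul_left_cancel₀ h0 h ▸ v.isUnit

theorem PNormal.pAssoc_iff_associated {a b : D} (hb : PNormal b) :
    PAssoc a b ↔ Associated a b := by
  constructor
  · rintro ⟨u, v, rfl⟩
    obtain ⟨w, hw⟩ := hb.exists_unit_mul_eq u
    refine Associated.symm ⟨w * v, ?_⟩
    rw [hw, Units.val_mul, mul_assoc]
  · intro h
    obtain ⟨u, hu⟩ := h.symm
    exact ⟨1, u, by simp [hu]⟩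

theorem Associated.mul_of_pNormal {a a' b b' : D} (hb : PNormal b) (h : Associated a a')
    (h' : Associated b b') : Associated (a * b) (a' * b') := by
  obtain ⟨u, rfl⟩ := h
  obtain ⟨v, rfl⟩ := h'
  obtain ⟨w, hw⟩ := hb.exists_unit_mul_eq u
  refine ⟨w * v, ?_⟩
  rw [Units.val_mul, mul_assoc a (u : D), ← mul_assoc (u : D), hw]
  simp only [mul_assoc]

theorem PIrred.not_isUnit_mul {p x : D} (hp : PIrred p) : ¬ IsUnit (p * x) :=
  fun h => hp.1.2 (isUnit_of_mul_isUnit_left h)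

theorem PIrred.mul_unit {p : D} (hp : PIrred p) (u : Dˣ) : PIrred (p * u) := by
  refine ⟨⟨by simpa using hp.1.1, hp.not_isUnit_mul⟩, fun y z h => ?_⟩
  have h' : p = y * (z * (u⁻¹ : Dˣ)) := by rw [← mul_assoc, ← h]; simp
  exact (hp.2 _ _ h').imp_right isUnit_of_mul_isUnit_left

/-- Irreducible elements commute up to associates if they are prime. -/
theorem associated_mul_comm_of_prime (hN : ∀ a : D, PNormal a) {p q : D} (hp : PIrred p)
    (hq : PIrred q) (hprime : ∀ a b : D, p ∣ a * b → p ∣ a ∨ p ∣ b) :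
    Associated (p * q) (q * p) := by
  obtain ⟨r, hr⟩ := (hN q).exists_mul_eq p
  obtain h | ⟨c, rfl⟩ := hprime q r ⟨q, hr.symm⟩
  · have h' := hp.associated_of_dvd hq h
    exact ((Associated.refl p).mul_of_pNormal (hN p) h').symm.trans
      (h'.mul_of_pNormal (hN p) (Associated.refl p))
  obtain ⟨s, hs⟩ := (hN q).exists_eq_mul p
  obtain ⟨c', hc'⟩ := (hN q).exists_eq_mul c
  have hsc : p = s * c' := by
    apply mul_right_cancel₀ hq.1.1
    rw [hr, ← mul_assoc, hs, mul_assoc, hc', mul_assoc]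
  obtain h | h := hp.2 s c' hsc
  · exact absurd ((hN q).isUnit_of_mul_eq hq.1.1 hs h) hp.1.2
  · obtain ⟨u, rfl⟩ := (hN q).isUnit_of_mul_eq hq.1.1 hc' h
    exact Associated.symm ⟨u, by rw [hr, mul_assoc]⟩

theorem List.Perm.associated_prod_of_prime (hN : ∀ a : D, PNormal a)
    (hprime : ∀ p : D, PIrred p → ∀ a b : D, p ∣ a * b → p ∣ a ∨ p ∣ b)
    {l t : List D} (h : l.Perm t) (hl : ∀ p ∈ l, PIrred p) : Associated l.prod t.prod := by
  induction h with
  | nil => exact Associated.refl _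
  | cons x _ ih =>
    rw [List.prod_cons, List.prod_cons]
    exact (Associated.refl x).mul_of_pNormal (hN _) (ih fun p hp => hl p (by simp [hp]))
  | swap x y l =>
    simp only [List.prod_cons, ← mul_assoc]
    have hy := hl y (by simp)
    exact (associated_mul_comm_of_prime hN hy (hl x (by simp))
      (hprime y hy)).mul_of_pNormal (hN _) (Associated.refl _)
  | trans h₁ _ ih₁ ih₂ => exact (ih₁ hl).trans (ih₂ fun p hp => hl p (h₁.mem_iff.2 hp))

theorem PIrred.exists_mem_dvd_of_dvd_prod {p : D} (hp : PIrred p)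
    (hprime : ∀ a b : D, p ∣ a * b → p ∣ a ∨ p ∣ b) {l : List D} (h : p ∣ l.prod) :
    ∃ q ∈ l, p ∣ q := by
  induction l with
  | nil =>
    obtain ⟨c, hc⟩ := h
    exact absurd (by rw [← hc]; simp) (hp.not_isUnit_mul (x := c))
  | cons q l ih =>
    rw [List.prod_cons] at h
    obtain h | h := hprime _ _ h
    · exact ⟨q, by simp, h⟩
    · obtain ⟨r, hr, h⟩ := ih h
      exact ⟨r, by simp [hr], h⟩

theorem exists_perm_forall₂_associated (hN : ∀ a : D, PNormal a)
    (hprime : ∀ p : D, PIrred p → ∀ a b : D, p ∣ a * b → p ∣ a ∨ p ∣ b)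
    {l t : List D} (hl : ∀ p ∈ l, PIrred p) (ht : ∀ p ∈ t, PIrred p)
    (h : Associated l.prod t.prod) :
    ∃ t' : List D, t'.Perm t ∧ List.Forall₂ Associated l t' := by
  induction l generalizing t with
  | nil =>
    cases t with
    | nil => exact ⟨[], .nil, .nil⟩
    | cons q t =>
      obtain ⟨u, hu⟩ := h
      refine absurd ?_ ((ht q (by simp)).not_isUnit_mul (x := t.prod))
      rw [← List.prod_cons, ← hu]
      simp
  | cons p l ih =>
    have hp := hl p (by simp)
    have hdvd : p ∣ t.prod := by
      obtain ⟨u, hu⟩ := h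
      exact ⟨l.prod * u, by rw [← hu, List.prod_cons, mul_assoc]⟩
    obtain ⟨q, hq, hpq⟩ := hp.exists_mem_dvd_of_dvd_prod (hprime p hp) hdvd
    have hpq := hp.associated_of_dvd (ht q hq) hpq
    obtain ⟨t₁, t₂, rfl⟩ := List.append_of_mem hq
    have hperm : (t₁ ++ q :: t₂).Perm (q :: (t₁ ++ t₂)) := List.perm_middle
    have h₁ : Associated (p * l.prod) (p * (t₁ ++ t₂).prod) := by
      have h₂ := h.trans (hperm.associated_prod_of_prime hN hprime ht)
      rw [List.prod_cons, List.prod_cons] at h₂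
      exact h₂.trans (hpq.symm.mul_of_pNormal (hN _) (Associated.refl _))
    obtain ⟨u, hu⟩ := h₁
    rw [mul_assoc] at hu
    obtain ⟨t', ht', hf⟩ := ih (fun x hx => hl x (by simp [hx]))
      (fun x hx => ht x (hperm.mem_iff.2 (by simp at hx ⊢; tauto)))
      ⟨u, mul_left_cancel₀ hp.1.1 hu⟩
    exact ⟨q :: t', (ht'.cons q).trans hperm.symm, .cons hpq hf⟩

/-- In an n-UFD, an irreducible dividing a product of normal irreducibles divides a factor. -/
theorem NUFD.exists_mem_dvd (hU : NUFD D) {p : D} (hp : PIrred p) {l : List D}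
    (hl : ∀ q ∈ l, PNormal q ∧ PIrred q) (hl0 : l.prod ≠ 0) (h : p ∣ l.prod) :
    ∃ q ∈ l, p ∣ q := by
  have hN := hU.1.pNormal
  obtain ⟨c, hc⟩ := h
  have hr : NNU (p * c) := ⟨hc ▸ hl0, hp.not_isUnit_mul⟩
  obtain ⟨p', t, hpp', hp', ht, hprod⟩ : ∃ (p' : D) (t : List D), Associated p p' ∧ PIrred p' ∧
      (∀ q ∈ t, PNormal q ∧ PIrred q) ∧ p * c = (p' :: t).prod := by
    by_cases hu : IsUnit c
    · obtain ⟨u, rfl⟩ := hu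
      exact ⟨p * u, [], ⟨u, rfl⟩, hp.mul_unit u, by simp, by simp⟩
    · obtain ⟨t, -, ht, rfl⟩ := hU.1 c ⟨right_ne_zero_of_mul hr.1, hu⟩
      exact ⟨p, t, .refl p, hp, ht, by simp⟩
  obtain ⟨σ, hσ⟩ := hU.2 (p * c) hr (p' :: t) l
    ⟨by simpa using ⟨⟨hN p', hp'⟩, ht⟩, hprod⟩ ⟨hl, hc.symm⟩
  obtain ⟨u, hu⟩ := hpp'.trans ((hN _).pAssoc_iff_associated.1 (hσ ⟨0, by simp⟩))
  exact ⟨_, List.get_mem _ _, u, hu.symm⟩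

end Domain

theorem List.Perm.exists_equiv_of_forall₂ {α : Type*} {R : α → α → Prop} {l t t' : List α}
    (h : t'.Perm t) (hf : List.Forall₂ R l t') :
    ∃ σ : Fin l.length ≃ Fin t.length, ∀ i, R (l.get i) (t.get (σ i)) := by
  classical
  refine ⟨(finCongr hf.length_eq).trans
    (.ofBijective h.idxBij ⟨h.idxBij_injective, h.idxBij_surjective⟩), fun i => ?_⟩
  have h' : t.get (h.idxBij (finCongr hf.length_eq i)) = t'.get (finCongr hf.length_eq i) :=
    h.getElem_idxBij_eq_getElem _
  change R (l.get i) (t.get (h.idxBij (finCongr hf.length_eq i)))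
  rw [h']
  exact hf.get i.2 (hf.length_eq ▸ i.2)

/-- An n-atomic domain is an n-UFD iff every normal irreducible
element is prime. -/
theorem nufd_iff_normal_irreducible_prime {D : Type*} [Ring D] [IsDomain D]
    (hat : NAtomic D) :
    NUFD D ↔ ∀ p : D, PNormal p → PIrred p →
      ∀ a b : D, PDvd p (a * b) → PDvd p a ∨ PDvd p b := by
  have hN := hat.pNormal
  constructor
  · intro hU p _ hp a b h
    simp only [(hN p).pDvd_iff_dvd] at h ⊢
    by_cases ha0 : a = 0
    · exact .inl (ha0 ▸ dvd_zero p)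
    by_cases hb0 : b = 0
    · exact .inr (hb0 ▸ dvd_zero p)
    by_cases hau : IsUnit a
    · obtain ⟨c, hc⟩ := h
      obtain ⟨u, rfl⟩ := hau
      obtain ⟨v, hv⟩ := (hN p).exists_unit_mul_eq u⁻¹
      exact .inr ⟨v * c, by rw [← mul_assoc, ← hv, mul_assoc, ← hc]; simp⟩
    by_cases hbu : IsUnit b
    · obtain ⟨c, hc⟩ := h
      obtain ⟨u, rfl⟩ := hbu
      exact .inl ⟨c * (u⁻¹ : Dˣ), by rw [← mul_assoc, ← hc]; simp⟩
    obtain ⟨l, -, hl, rfl⟩ := hat a ⟨ha0, hau⟩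
    obtain ⟨t, -, ht, rfl⟩ := hat b ⟨hb0, hbu⟩
    rw [← List.prod_append] at h
    obtain ⟨q, hq, c, rfl⟩ := hU.exists_mem_dvd hp
      (fun q hq => (List.mem_append.1 hq).elim (hl q) (ht q))
      (by rw [List.prod_append]; exact mul_ne_zero ha0 hb0) h
    exact (List.mem_append.1 hq).imp (dvd_list_prod_of_dvd_mem hN · ⟨c, rfl⟩)
      (dvd_list_prod_of_dvd_mem hN · ⟨c, rfl⟩)
  · intro hprime
    have hprime' : ∀ p : D, PIrred p → ∀ a b : D, p ∣ a * b → p ∣ a ∨ p ∣ b := by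
      intro p hp a b
      simpa only [(hN p).pDvd_iff_dvd] using hprime p (hN p) hp a b
    refine ⟨hat, fun r _ l t hl ht => ?_⟩
    obtain ⟨t', ht', hf⟩ := exists_perm_forall₂_associated hN hprime' (fun p hp => (hl.1 p hp).2)
      (fun p hp => (ht.1 p hp).2) (by rw [← hl.2, ← ht.2])
    exact ht'.exists_equiv_of_forall₂ (hf.imp fun a b h => (hN b).pAssoc_iff_associated.2 h)
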